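/- arXiv:2602.19014 — 2 statements merged into one kernel-verified Lean document; each statement's English description precedes it below -/
import Mathlib

section
/- Let Γ be a discrete abelian group, A, B ⊆ Γ nonempty, and let K ≤ Γ be a finite-index subgroup which is a KJ-stabilizer of A+B; write k := [Γ:K]. If m is an invariant mean on ℓ^∞(Γ) satisfying δ := m(A) + m(B) − m(A+B) > 0, then there is an invariant mean m' on ℓ^∞(Γ) such that: (1) m' is a kδ-restriction of m; (2) m'(A+B) = m'(A+B+K); (3) m'(A) + m'(B) − m'(A+B) ≥ δ. -/
open scoped Pointwise
open Filter

namespace SumsetMeans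

variable (Γ : Type*) [AddCommGroup Γ] [TopologicalSpace Γ] [DiscreteTopology Γ]

/-- The indicator function of `A ⊆ Γ` as a bounded (continuous, since `Γ` is discrete)
real-valued function, i.e. as an element of `ℓ^∞(Γ)`. -/
noncomputable def ind (A : Set Γ) : BoundedContinuousFunction Γ ℝ :=
  BoundedContinuousFunction.ofNormedAddCommGroup (Set.indicator A 1)
    continuous_of_discreteTopology 1
    (fun x => by by_cases h : x ∈ A <;> simp [Set.indicator_apply, h])

/-- The translate `τ_γ f`, given by `(τ_γ f)(x) = f (x - γ)`. -/
noncomputable def translate (γ : Γ) (f : BoundedContinuousFunction Γ ℝ) :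
    BoundedContinuousFunction Γ ℝ :=
  f.compContinuous ⟨fun x => x - γ, continuous_of_discreteTopology⟩

/-- An invariant mean on `ℓ^∞(Γ)`: a linear functional with `m 1 = 1`, nonnegative on
nonnegative functions, and invariant under all translations. -/
structure IsInvariantMean (m : BoundedContinuousFunction Γ ℝ →ₗ[ℝ] ℝ) : Prop where
  map_one : m 1 = 1
  nonneg : ∀ f : BoundedContinuousFunction Γ ℝ, (∀ x, 0 ≤ f x) → 0 ≤ m f
  invariant : ∀ (γ : Γ) (f : BoundedContinuousFunction Γ ℝ), m (translate Γ γ f) = m f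

/-- The value `m(A) := m(1_A)` of a mean on a set `A ⊆ Γ`. -/
noncomputable def mVal (m : BoundedContinuousFunction Γ ℝ →ₗ[ℝ] ℝ) (A : Set Γ) : ℝ :=
  m (ind Γ A)

/-- Upper Banach density: `d*(A) = sup { m(A) : m an invariant mean on ℓ^∞(Γ) }`. -/
noncomputable def ubd (A : Set Γ) : ℝ :=
  sSup {x : ℝ | ∃ m, IsInvariantMean Γ m ∧ mVal Γ m A = x}

/-- An extreme invariant mean: an extreme point of the convex set of invariant means. -/
def IsExtremeInvariantMean (ν : BoundedContinuousFunction Γ ℝ →ₗ[ℝ] ℝ) : Prop :=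
  ν ∈ Set.extremePoints ℝ {m : BoundedContinuousFunction Γ ℝ →ₗ[ℝ] ℝ | IsInvariantMean Γ m}

/-- `K` is a KJ-stabilizer of `A + B`: a finite-index subgroup such that for every extreme
invariant mean `ν` with `ν(A+B) < ν(A) + ν(B)` one has `ν(A+B) = ν(A+B+K)`, the Kneser
equation `ν(A+B+K) = ν(A+K) + ν(B+K) - ν(K)`, and `K` is the stabilizer of `A+B+K`. -/
def IsKJStabilizer (A B : Set Γ) (K : AddSubgroup Γ) : Prop :=
  K.FiniteIndex ∧
  ∀ ν : BoundedContinuousFunction Γ ℝ →ₗ[ℝ] ℝ, IsExtremeInvariantMean Γ ν →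
    mVal Γ ν (A + B) < mVal Γ ν A + mVal Γ ν B →
      mVal Γ ν (A + B) = mVal Γ ν (A + B + (K : Set Γ)) ∧
      mVal Γ ν (A + B + (K : Set Γ)) =
        mVal Γ ν (A + (K : Set Γ)) + mVal Γ ν (B + (K : Set Γ)) - mVal Γ ν (K : Set Γ) ∧
      (K : Set Γ) = {γ : Γ | A + B + (K : Set Γ) + {γ} = A + B + (K : Set Γ)}

/-- `m'` is a `β`-restriction of `m`: there are sets `C n ⊆ Γ` with
`lim m(C n)` existing and `≥ β`, `lim_N sup_{n,n'≥N} m(C n Δ C n') = 0`, and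
`m' f = lim m(C n)⁻¹ m(f · 1_{C n})` for every bounded `f`. -/
def IsBetaRestriction (β : ℝ) (m m' : BoundedContinuousFunction Γ ℝ →ₗ[ℝ] ℝ) : Prop :=
  ∃ C : ℕ → Set Γ, ∃ L : ℝ, β ≤ L ∧
    Tendsto (fun n => mVal Γ m (C n)) atTop (nhds L) ∧
    (∀ ε : ℝ, 0 < ε → ∃ N : ℕ, ∀ n n' : ℕ, N ≤ n → N ≤ n' →
      mVal Γ m (symmDiff (C n) (C n')) < ε) ∧
    ∀ f : BoundedContinuousFunction Γ ℝ,
      Tendsto (fun n => (mVal Γ m (C n))⁻¹ * m (f * ind Γ (C n))) atTop (nhds (m' f))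

section Means

open scoped BoundedContinuousFunction

variable {Γ}
variable {m : (Γ →ᵇ ℝ) →ₗ[ℝ] ℝ}

theorem ind_apply (A : Set Γ) (x : Γ) : ind Γ A x = Set.indicator A 1 x := rfl

theorem ind_apply_of_mem {A : Set Γ} {x : Γ} (hx : x ∈ A) : ind Γ A x = 1 := by
  simp [ind_apply, hx]

theorem ind_apply_of_notMem {A : Set Γ} {x : Γ} (hx : x ∉ A) : ind Γ A x = 0 := by
  simp [ind_apply, hx]

theorem translate_apply (γ : Γ) (f : Γ →ᵇ ℝ) (x : Γ) : translate Γ γ f x = f (x - γ) := rfl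

theorem translate_zero (f : Γ →ᵇ ℝ) : translate Γ 0 f = f := by
  ext x; simp [translate_apply]

namespace IsInvariantMean

theorem mono (hm : IsInvariantMean Γ m) {f g : Γ →ᵇ ℝ} (h : ∀ x, f x ≤ g x) : m f ≤ m g := by
  have := hm.nonneg (g - f) fun x => by simpa using h x
  simpa using this

theorem abs_apply_le (hm : IsInvariantMean Γ m) {f s : Γ →ᵇ ℝ} {c : ℝ}
    (h : ∀ x, |f x| ≤ c * s x) : |m f| ≤ c * m s := by
  have h1 := hm.mono (f := f) (g := c • s) fun x => (le_abs_self _).trans (h x)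
  have h2 := hm.mono (f := -f) (g := c • s) fun x => (neg_le_abs _).trans (h x)
  rw [map_smul, smul_eq_mul] at h1 h2
  rw [map_neg] at h2
  exact abs_le.2 ⟨by linarith, h1⟩

theorem mVal_mono (hm : IsInvariantMean Γ m) {A B : Set Γ} (h : A ⊆ B) :
    mVal Γ m A ≤ mVal Γ m B :=
  hm.mono fun x => Set.indicator_le_indicator_of_subset h (fun _ => zero_le_one) x

theorem mVal_le_one (hm : IsInvariantMean Γ m) (A : Set Γ) : mVal Γ m A ≤ 1 :=
  (hm.mono fun x => Set.indicator_le_self' (fun _ _ => zero_le_one) x).trans_eq hm.map_one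

end IsInvariantMean

theorem isCompact_image_coe_isInvariantMean :
    IsCompact ((fun n : (Γ →ᵇ ℝ) →ₗ[ℝ] ℝ => (n : (Γ →ᵇ ℝ) → ℝ)) ''
      {n | IsInvariantMean Γ n}) := by
  refine (isCompact_univ_pi fun f : Γ →ᵇ ℝ =>
    isCompact_Icc (a := -‖f‖) (b := ‖f‖)).of_isClosed_subset ?_ ?_
  · have : ((fun n : (Γ →ᵇ ℝ) →ₗ[ℝ] ℝ => (n : (Γ →ᵇ ℝ) → ℝ)) '' {n | IsInvariantMean Γ n}) =
        {φ | (∀ f g, φ (f + g) = φ f + φ g) ∧ (∀ (c : ℝ) f, φ (c • f) = c * φ f) ∧ φ 1 = 1 ∧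
          (∀ f : Γ →ᵇ ℝ, (∀ x, 0 ≤ f x) → 0 ≤ φ f) ∧ ∀ γ f, φ (translate Γ γ f) = φ f} := by
      ext φ
      constructor
      · rintro ⟨n, hn, rfl⟩
        exact ⟨map_add n, map_smul n, hn.map_one, hn.nonneg, hn.invariant⟩
      · rintro ⟨h1, h2, h3, h4, h5⟩
        exact ⟨⟨⟨φ, h1⟩, h2⟩, ⟨h3, h4, h5⟩, rfl⟩
    rw [this]
    simp only [Set.ofPred_and, Set.ofPred_forall]
    refine .inter ?_ (.inter ?_ (.inter ?_ (.inter ?_ ?_)))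
    · exact isClosed_iInter fun f => isClosed_iInter fun g =>
        isClosed_eq (by fun_prop) (by fun_prop)
    · exact isClosed_iInter fun f => isClosed_iInter fun g =>
        isClosed_eq (by fun_prop) (by fun_prop)
    · exact isClosed_eq (by fun_prop) (by fun_prop)
    · exact isClosed_iInter fun f => isClosed_iInter fun _ =>
        isClosed_le (by fun_prop) (by fun_prop)
    · exact isClosed_iInter fun f => isClosed_iInter fun g =>
        isClosed_eq (by fun_prop) (by fun_prop)
  · rintro _ ⟨n, hn, rfl⟩ f -
    have := hn.abs_apply_le (f := f) (s := 1) (c := ‖f‖) fun x => by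
      simpa using f.norm_coe_le_norm x
    rw [hn.map_one, mul_one] at this
    exact abs_le.1 this

/-- A continuous linear functional on invariant means attains its minimum at an extreme one. -/
theorem IsInvariantMean.exists_isExtremeInvariantMean_le (hm : IsInvariantMean Γ m)
    (f : Γ →ᵇ ℝ) : ∃ ν, IsExtremeInvariantMean Γ ν ∧ ν f ≤ m f := by
  set T := (fun n : (Γ →ᵇ ℝ) →ₗ[ℝ] ℝ => (n : (Γ →ᵇ ℝ) → ℝ)) '' {n | IsInvariantMean Γ n}
  have hTc : IsCompact T := isCompact_image_coe_isInvariantMean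
  let l : StrongDual ℝ ((Γ →ᵇ ℝ) → ℝ) := -ContinuousLinearMap.proj f
  let F : Set ((Γ →ᵇ ℝ) → ℝ) := {φ ∈ T | ∀ ψ ∈ T, l ψ ≤ l φ}
  have hF : IsExposed ℝ T F := fun _ => ⟨l, rfl⟩
  obtain ⟨φ₀, hφ₀, hmax⟩ := hTc.exists_isMaxOn ⟨_, m, hm, rfl⟩ l.continuous.continuousOn
  have hFc : IsCompact F := hF.isCompact hTc
  obtain ⟨φ, hφ⟩ := hFc.extremePoints_nonempty ⟨φ₀, hφ₀, fun ψ hψ => hmax hψ⟩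
  have hφT := hF.isExtreme.extremePoints_subset_extremePoints hφ
  obtain ⟨ν, hν, hνφ⟩ := hφT.1
  refine ⟨ν, ⟨hν, fun n₁ h₁ n₂ h₂ hseg => ?_⟩, ?_⟩
  · refine DFunLike.coe_injective ((hφT.2 ⟨n₁, h₁, rfl⟩ ⟨n₂, h₂, rfl⟩ ?_).trans hνφ.symm)
    obtain ⟨a, b, ha, hb, hab, h⟩ := hseg
    refine ⟨a, b, ha, hb, hab, ?_⟩
    rw [← hνφ, ← h]
    rfl
  · have := hφ.1.2 _ ⟨m, hm, rfl⟩
    simp only [l, neg_apply, ContinuousLinearMap.proj_apply, neg_le_neg_iff,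
      ← hνφ] at this
    exact this

theorem IsInvariantMean.nonneg_of_forall_isExtremeInvariantMean (hm : IsInvariantMean Γ m)
    {f : Γ →ᵇ ℝ} (h : ∀ ν, IsExtremeInvariantMean Γ ν → 0 ≤ ν f) : 0 ≤ m f := by
  obtain ⟨ν, hν, hle⟩ := hm.exists_isExtremeInvariantMean_le f
  exact (h ν hν).trans hle

theorem IsInvariantMean.index_mul_mVal_coe (hm : IsInvariantMean Γ m) (K : AddSubgroup Γ)
    [K.FiniteIndex] : (K.index : ℝ) * mVal Γ m (K : Set Γ) = 1 := by
  classical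
  have := Fintype.ofFinite (Γ ⧸ K)
  have hsum : (1 : Γ →ᵇ ℝ) = ∑ q : Γ ⧸ K, translate Γ q.out (ind Γ (K : Set Γ)) := by
    ext x
    rw [BoundedContinuousFunction.coe_sum, Finset.sum_apply,
      Finset.sum_eq_single (QuotientAddGroup.mk x : Γ ⧸ K)]
    · rw [translate_apply, ind_apply_of_mem]
      · rfl
      · rw [SetLike.mem_coe, sub_eq_neg_add, ← QuotientAddGroup.eq]
        exact Quotient.out_eq' _
    · intro q _ hq
      rw [translate_apply, ind_apply_of_notMem]
      rw [SetLike.mem_coe, sub_eq_neg_add, ← QuotientAddGroup.eq]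
      intro h
      exact hq ((Quotient.out_eq' q).symm.trans h)
    · simp
  have h1 := hm.map_one
  rw [hsum, map_sum] at h1
  simp only [hm.invariant, Finset.sum_const, Finset.card_univ, nsmul_eq_mul] at h1
  rwa [AddSubgroup.index_eq_card, Nat.card_eq_fintype_card]

/-- The functions bounded by `‖g‖` that no invariant mean separates from `g`; these include all
averages of translates of `g`. -/
def meanFiber (g : Γ →ᵇ ℝ) : Set (Γ →ᵇ ℝ) :=
  {f | (∀ x, |f x| ≤ ‖g‖) ∧ ∀ n, IsInvariantMean Γ n → n f = n g}

theorem self_mem_meanFiber (g : Γ →ᵇ ℝ) : g ∈ meanFiber g :=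
  ⟨g.norm_coe_le_norm, fun _ _ => rfl⟩

theorem translate_mem_meanFiber {f g : Γ →ᵇ ℝ} (γ : Γ) (hf : f ∈ meanFiber g) :
    translate Γ γ f ∈ meanFiber g :=
  ⟨fun x => hf.1 (x - γ), fun n hn => (hn.invariant γ f).trans (hf.2 n hn)⟩

theorem midpoint_mem_meanFiber {f f' g : Γ →ᵇ ℝ} (hf : f ∈ meanFiber g)
    (hf' : f' ∈ meanFiber g) : (2⁻¹ : ℝ) • (f + f') ∈ meanFiber g := by
  refine ⟨fun x => ?_, fun n hn => ?_⟩
  · have h1 := abs_le.1 (hf.1 x)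
    have h2 := abs_le.1 (hf'.1 x)
    simp only [BoundedContinuousFunction.smul_apply, BoundedContinuousFunction.add_apply,
      smul_eq_mul]
    exact abs_le.2 ⟨by linarith, by linarith⟩
  · rw [map_smul, map_add, hf.2 n hn, hf'.2 n hn, smul_eq_mul]
    ring

/-- A weak form of the mean ergodic theorem: elements of the fiber of `g` of nearly minimal
`L²(m)`-norm are close to each other and to their translates. -/
theorem IsInvariantMean.exists_seq_meanFiber (hm : IsInvariantMean Γ m) (g : Γ →ᵇ ℝ)
    {η : ℕ → ℝ} (hη : ∀ j, 0 < η j) (hanti : Antitone η) :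
    ∃ f : ℕ → Γ →ᵇ ℝ, (∀ j, f j ∈ meanFiber g) ∧ ∀ γ j k, j ≤ k →
      m ((translate Γ γ (f j) - f k) * (translate Γ γ (f j) - f k)) ≤ 4 * η j := by
  have hsq : ∀ f : Γ →ᵇ ℝ, 0 ≤ m (f * f) := fun f => hm.nonneg _ fun x => mul_self_nonneg (f x)
  set Q : Set ℝ := (fun f : Γ →ᵇ ℝ => m (f * f)) '' meanFiber g
  have hbdd : BddBelow Q := ⟨0, by rintro _ ⟨f, -, rfl⟩; exact hsq f⟩
  have hne : Q.Nonempty := ⟨_, g, self_mem_meanFiber g, rfl⟩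
  have hex : ∀ j, ∃ f ∈ meanFiber g, m (f * f) < sInf Q + η j := fun j => by
    obtain ⟨_, ⟨f, hf, rfl⟩, h⟩ := exists_lt_of_csInf_lt hne (lt_add_of_pos_right (sInf Q) (hη j))
    exact ⟨f, hf, h⟩
  choose f hf hlt using hex
  refine ⟨f, hf, fun γ j k hjk => ?_⟩
  set p := translate Γ γ (f j)
  have hpm : p ∈ meanFiber g := translate_mem_meanFiber γ (hf j)
  have hpp : m (p * p) = m (f j * f j) := hm.invariant γ (f j * f j)
  have hmid : sInf Q ≤ m (((2⁻¹ : ℝ) • (p + f k)) * ((2⁻¹ : ℝ) • (p + f k))) :=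
    csInf_le hbdd ⟨_, midpoint_mem_meanFiber hpm (hf k), rfl⟩
  have hpar : (p - f k) * (p - f k) = (2 : ℝ) • (p * p) + (2 : ℝ) • (f k * f k)
      - (4 : ℝ) • (((2⁻¹ : ℝ) • (p + f k)) * ((2⁻¹ : ℝ) • (p + f k))) := by
    ext x
    simp only [BoundedContinuousFunction.mul_apply, BoundedContinuousFunction.sub_apply,
      BoundedContinuousFunction.add_apply, BoundedContinuousFunction.smul_apply, smul_eq_mul]
    ring
  rw [hpar, map_sub, map_add, map_smul, map_smul, map_smul]
  simp only [smul_eq_mul]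
  linarith [hlt j, hlt k, hanti hjk]

/-- The sets `C j` converge in `m`-measure, at rate `e`, to an invariant set. -/
def IsAsymptoticallyInvariant (m : (Γ →ᵇ ℝ) →ₗ[ℝ] ℝ) (C : ℕ → Set Γ) (e : ℕ → ℝ) : Prop :=
  ∀ γ j k, j < k → ∃ s : Γ →ᵇ ℝ,
    (∀ x, |translate Γ γ (ind Γ (C j)) x - ind Γ (C k) x| ≤ s x) ∧ m s ≤ e j

namespace IsAsymptoticallyInvariant

variable {C : ℕ → Set Γ} {e : ℕ → ℝ}

theorem nonneg (hm : IsInvariantMean Γ m) (hC : IsAsymptoticallyInvariant m C e) (j : ℕ) :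
    0 ≤ e j := by
  obtain ⟨s, hs, hle⟩ := hC 0 j (j + 1) j.lt_succ_self
  exact (hm.nonneg s fun x => (abs_nonneg _).trans (hs x)).trans hle

theorem abs_sub_le (hm : IsInvariantMean Γ m) (hC : IsAsymptoticallyInvariant m C e)
    {f : Γ →ᵇ ℝ} {c : ℝ} (hf : ∀ x, |f x| ≤ c) (γ : Γ) {j k : ℕ} (hjk : j < k) :
    |m (f * translate Γ γ (ind Γ (C j))) - m (f * ind Γ (C k))| ≤ c * e j := by
  obtain ⟨s, hs, hle⟩ := hC γ j k hjk
  have hc : 0 ≤ c := (abs_nonneg _).trans (hf 0)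
  rw [← map_sub, ← mul_sub]
  refine (hm.abs_apply_le (s := s) (c := c) fun x => ?_).trans (mul_le_mul_of_nonneg_left hle hc)
  rw [BoundedContinuousFunction.mul_apply, abs_mul]
  exact mul_le_mul (hf x) (hs x) (abs_nonneg _) hc

theorem mVal_symmDiff_le (hm : IsInvariantMean Γ m) (hC : IsAsymptoticallyInvariant m C e)
    {j k : ℕ} (hjk : j ≤ k) : mVal Γ m (symmDiff (C j) (C k)) ≤ e j := by
  rcases hjk.eq_or_lt with rfl | hjk
  · have : ind Γ (symmDiff (C j) (C j)) = 0 := by ext x; simp [ind_apply]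
    rw [mVal, this, map_zero]
    exact hC.nonneg hm j
  · obtain ⟨s, hs, hle⟩ := hC 0 j k hjk
    refine (hm.mono fun x => le_trans ?_ (hs x)).trans hle
    rw [translate_zero]
    by_cases h1 : x ∈ C j <;> by_cases h2 : x ∈ C k <;>
      simp [ind_apply, Set.mem_symmDiff, h1, h2]

theorem exists_isBetaRestriction (hm : IsInvariantMean Γ m)
    (hC : IsAsymptoticallyInvariant m C e) (he : Tendsto e atTop (nhds 0)) {L : ℝ} (hL : 0 < L)
    (ha : Tendsto (fun j => mVal Γ m (C j)) atTop (nhds L)) :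
    ∃ m', IsInvariantMean Γ m' ∧ IsBetaRestriction Γ L m m' ∧
      ∀ (f : Γ →ᵇ ℝ) (c : ℝ), (∀ x, |f x| ≤ c) →
        ∀ j, |m (f * ind Γ (C j)) - L * m' f| ≤ c * e j := by
  have habs : ∀ f : Γ →ᵇ ℝ, ∀ x, |f x| ≤ ‖f‖ := fun f => f.norm_coe_le_norm
  have hdist : ∀ (f : Γ →ᵇ ℝ) (c : ℝ), (∀ x, |f x| ≤ c) → ∀ j k, j ≤ k →
      |m (f * ind Γ (C j)) - m (f * ind Γ (C k))| ≤ c * e j := fun f c hf j k hjk => by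
    rcases hjk.eq_or_lt with rfl | hjk
    · rw [sub_self, abs_zero]
      exact mul_nonneg ((abs_nonneg _).trans (hf 0)) (hC.nonneg hm j)
    · simpa only [translate_zero] using hC.abs_sub_le hm hf 0 hjk
  have hlim : ∀ f : Γ →ᵇ ℝ, ∃ l, Tendsto (fun j => m (f * ind Γ (C j))) atTop (nhds l) :=
    fun f => cauchySeq_tendsto_of_complete <|
      cauchySeq_of_le_tendsto_0' (fun j => ‖f‖ * e j) (hdist f _ (habs f))
        (by simpa using he.const_mul ‖f‖)
  choose M hM using hlim
  have hMinv : ∀ γ f, M (translate Γ γ f) = M f := fun γ f => by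
    have h1 : Tendsto (fun j => m (translate Γ γ f * ind Γ (C j)) - m (f * ind Γ (C (j + 1))))
        atTop (nhds (M (translate Γ γ f) - M f)) :=
      (hM _).sub ((hM f).comp (tendsto_add_atTop_nat 1))
    have h2 : Tendsto (fun j => m (translate Γ γ f * ind Γ (C j)) - m (f * ind Γ (C (j + 1))))
        atTop (nhds 0) := by
      refine squeeze_zero_norm (a := fun j => ‖f‖ * e j) (fun j => ?_)
        (by simpa using he.const_mul ‖f‖)
      have : translate Γ (-γ) (translate Γ γ f * ind Γ (C j)) =
          f * translate Γ (-γ) (ind Γ (C j)) := by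
        ext x
        simp [translate_apply]
      rw [← hm.invariant (-γ), this]
      exact hC.abs_sub_le hm (habs f) (-γ) j.lt_succ_self
    exact sub_eq_zero.1 (tendsto_nhds_unique h1 h2)
  let m' : (Γ →ᵇ ℝ) →ₗ[ℝ] ℝ :=
    { toFun := fun f => L⁻¹ * M f
      map_add' := fun f g => by
        rw [← mul_add]
        refine congrArg _ (tendsto_nhds_unique (hM (f + g)) ?_)
        simpa only [add_mul, map_add] using (hM f).add (hM g)
      map_smul' := fun c f => by
        rw [RingHom.id_apply, smul_eq_mul, mul_left_comm]
        refine congrArg _ (tendsto_nhds_unique (hM (c • f)) ?_)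
        simpa only [smul_mul_assoc, map_smul, smul_eq_mul] using (hM f).const_mul c }
  refine ⟨m', ⟨?_, fun f hf => ?_, fun γ f => congrArg (L⁻¹ * ·) (hMinv γ f)⟩,
    ⟨C, L, le_rfl, ha, fun ε hε => ?_, fun f => (ha.inv₀ hL.ne').mul (hM f)⟩, fun f c hf j => ?_⟩
  · have : M 1 = L := tendsto_nhds_unique (hM 1) (by simp only [one_mul]; exact ha)
    change L⁻¹ * M 1 = 1
    rw [this, inv_mul_cancel₀ hL.ne']
  · refine mul_nonneg (inv_nonneg.2 hL.le) (ge_of_tendsto' (hM f) fun j => hm.nonneg _ fun x => ?_)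
    exact mul_nonneg (hf x) (Set.indicator_nonneg (fun _ _ => zero_le_one) x)
  · obtain ⟨N, hN⟩ := eventually_atTop.1 (he.eventually_lt_const hε)
    refine ⟨N, fun n n' hn hn' => ?_⟩
    rcases le_total n n' with h | h
    · exact (hC.mVal_symmDiff_le hm h).trans_lt (hN n hn)
    · rw [symmDiff_comm]
      exact (hC.mVal_symmDiff_le hm h).trans_lt (hN n' hn')
  · have : L * m' f = M f := mul_inv_cancel_left₀ hL.ne' (M f)
    rw [this]
    exact le_of_tendsto ((hM f).const_sub _).abs
      (eventually_atTop.2 ⟨j, fun k hk => hdist f c hf j k hk⟩)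

end IsAsymptoticallyInvariant

theorem two_le_of_levels {t t' a b : ℝ} (ht : 0 < t) (htt' : t' ≤ t / 2) (ha : t < a)
    (hb : b < t / 2 ∨ b ≤ t') : 2 ≤ 8 / t ^ 2 * ((a - b) * (a - b)) := by
  have hab : t / 2 ≤ a - b := by rcases hb with hb | hb <;> linarith
  have : 8 / t ^ 2 * (t / 2 * (t / 2)) = 2 := by field_simp; norm_num
  rw [← this]
  have : 0 ≤ a - b := (half_pos ht).le.trans hab
  gcongr

theorem abs_sub_levels_le {t t' a b : ℝ} (ht : 0 < t) (htt' : t' ≤ t / 2) :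
    |(if t < a then (1 : ℝ) else 0) - if t' < b then 1 else 0| ≤
      (if t' < b then 1 else 0) - (if t < a then 1 else 0) +
        8 / t ^ 2 * ((a - b) * (a - b)) := by
  have h0 : 0 ≤ 8 / t ^ 2 * ((a - b) * (a - b)) :=
    mul_nonneg (by positivity) (mul_self_nonneg _)
  by_cases ha : t < a <;> by_cases hb : t' < b <;> simp only [ha, hb, if_true, if_false]
  · simpa using h0
  · have := two_le_of_levels ht htt' ha (.inr (not_lt.1 hb))
    norm_num
    linarith
  · norm_num
    exact h0
  · simpa using h0

theorem cutoff_mul_level_le {t t' a b : ℝ} (ht : 0 < t) (ht' : 0 ≤ t') (htt' : t' ≤ t / 2) :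
    max (1 - 2 / t * b) 0 * (if t' < b then 1 else 0) ≤
      (if t' < b then 1 else 0) - (if t < a then 1 else 0) +
        8 / t ^ 2 * ((a - b) * (a - b)) := by
  have h0 : 0 ≤ 8 / t ^ 2 * ((a - b) * (a - b)) :=
    mul_nonneg (by positivity) (mul_self_nonneg _)
  by_cases hb : t' < b
  · have hw : max (1 - 2 / t * b) 0 ≤ 1 := by
      have : 0 ≤ 2 / t * b := mul_nonneg (by positivity) (ht'.trans hb.le)
      exact max_le (by linarith) zero_le_one
    by_cases ha : t < a
    · simp only [ha, hb, if_true]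
      rcases lt_or_ge b (t / 2) with hbt | hbt
      · linarith [two_le_of_levels ht htt' ha (.inl hbt)]
      · have : 2 / t * (t / 2) ≤ 2 / t * b := by gcongr
        rw [show 2 / t * (t / 2) = 1 by field_simp] at this
        rw [max_eq_right (by linarith)]
        linarith
    · simp only [ha, hb, if_true, if_false]
      linarith
  · simp only [hb, if_false, mul_zero]
    by_cases ha : t < a
    · simp only [ha, if_true]
      linarith [two_le_of_levels ht htt' ha (.inr (not_lt.1 hb))]
    · simp only [ha, if_false]
      linarith

theorem half_pow_le_half {j k : ℕ} (hjk : j < k) : (1 / 2 : ℝ) ^ k ≤ (1 / 2) ^ j / 2 := by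
  calc (1 / 2 : ℝ) ^ k ≤ (1 / 2) ^ (j + 1) :=
        pow_le_pow_of_le_one (by norm_num) (by norm_num) hjk
    _ = (1 / 2) ^ j / 2 := by rw [pow_succ]; ring

/-- If `a` increases up to a summable geometric error then it converges, with explicit rate. -/
theorem exists_tendsto_of_almost_monotone {a : ℕ → ℝ} {c B : ℝ} (hc : 0 ≤ c) (hB : ∀ j, a j ≤ B)
    (h : ∀ j, a j ≤ a (j + 1) + c * (1 / 2) ^ j) :
    ∃ L, Tendsto a atTop (nhds L) ∧ ∀ k, a k - 2 * c * (1 / 2) ^ k ≤ L := by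
  have hmono : Monotone fun j => a j - 2 * c * (1 / 2) ^ j := monotone_nat_of_le_succ fun j => by
    have := h j
    simp only [pow_succ]
    linarith
  have hbdd : BddAbove (Set.range fun j => a j - 2 * c * (1 / 2) ^ j) := ⟨B, by
    rintro _ ⟨j, rfl⟩
    have : 0 ≤ 2 * c * (1 / 2) ^ j := by positivity
    change a j - 2 * c * (1 / 2) ^ j ≤ B
    linarith [hB j]⟩
  refine ⟨_, ?_, fun k => le_ciSup hbdd k⟩
  have h1 := tendsto_atTop_ciSup hmono hbdd
  have h2 : Tendsto (fun j : ℕ => 2 * c * (1 / 2 : ℝ) ^ j) atTop (nhds 0) := by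
    simpa using (tendsto_pow_atTop_nhds_zero_of_lt_one (r := (1 / 2 : ℝ)) (by norm_num)
      (by norm_num)).const_mul (2 * c)
  simpa using h1.add h2

/-- Let `0 ≤ u ≤ 1` vanish at every extreme invariant mean `ν` with `0 < ν g`, and let `ν g ≤ κ⁻¹`
there. Then `u` vanishes at the restriction of `m` to the invariant set where the ergodic average
of `g` is positive, and this set has `m`-measure at least `κ * m g`. -/
theorem IsInvariantMean.exists_isBetaRestriction (hm : IsInvariantMean Γ m) {g u : Γ →ᵇ ℝ}
    {κ : ℝ} (hκ : 0 < κ) (hu0 : ∀ x, 0 ≤ u x) (hu1 : ∀ x, u x ≤ 1)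
    (hext : ∀ ν, IsExtremeInvariantMean Γ ν → 0 < ν g → κ * ν g ≤ 1 ∧ ν u = 0)
    (hg : 0 < m g) :
    ∃ m', IsInvariantMean Γ m' ∧ IsBetaRestriction Γ (κ * m g) m m' ∧ m' u = 0 ∧ m g ≤ m' g := by
  have hκg : ∀ n, IsInvariantMean Γ n → κ * n g ≤ 1 := fun n hn => by
    have := hn.nonneg_of_forall_isExtremeInvariantMean (f := 1 - κ • g) fun ν hν => by
      rw [map_sub, map_smul, hν.1.map_one, smul_eq_mul, sub_nonneg]
      rcases lt_or_ge 0 (ν g) with h | h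
      · exact (hext ν hν h).1
      · exact (mul_nonpos_of_nonneg_of_nonpos hκ.le h).trans zero_le_one
    rw [map_sub, map_smul, hn.map_one, smul_eq_mul] at this
    linarith
  have hcut : ∀ n, IsInvariantMean Γ n → ∀ f ∈ meanFiber g, ∀ c : ℝ, 0 < c →
      n u ≤ n ((1 - c • f) ⊔ 0) := fun n hn f hf c hc => by
    have := hn.nonneg_of_forall_isExtremeInvariantMean (f := (1 - c • f) ⊔ 0 - u) fun ν hν => by
      have h1 : ν (1 - c • f) ≤ ν ((1 - c • f) ⊔ 0) := hν.1.mono fun x => le_max_left _ _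
      have h2 : ν 0 ≤ ν ((1 - c • f) ⊔ 0) := hν.1.mono fun x => le_max_right _ _
      have h3 : ν u ≤ ν 1 := hν.1.mono hu1
      rw [map_sub, map_smul, hν.1.map_one, smul_eq_mul, hf.2 ν hν.1] at h1
      rw [map_zero] at h2
      rw [hν.1.map_one] at h3
      rw [map_sub, sub_nonneg]
      rcases lt_or_ge 0 (ν g) with h | h
      · rwa [(hext ν hν h).2]
      · linarith [mul_nonpos_of_nonneg_of_nonpos hc.le h]
    rw [map_sub] at this
    linarith
  have htpos : ∀ j : ℕ, (0 : ℝ) < (1 / 2) ^ j := fun j => by positivity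
  obtain ⟨f, hf, hfm⟩ := hm.exists_seq_meanFiber g (η := fun j => ((1 / 2 : ℝ) ^ j) ^ 3)
    (fun j => by positivity) (fun j k hjk => pow_le_pow_left₀ (htpos k).le
      (pow_le_pow_of_le_one (by norm_num) (by norm_num) hjk) 3)
  let C : ℕ → Set Γ := fun j => {x | (1 / 2 : ℝ) ^ j < f j x}
  have hind : ∀ j x, ind Γ (C j) x = if (1 / 2 : ℝ) ^ j < f j x then 1 else 0 := fun j x => by
    simp [ind_apply, Set.indicator_apply, C]
  let s : Γ → ℕ → ℕ → Γ →ᵇ ℝ := fun γ j k =>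
    ind Γ (C k) - translate Γ γ (ind Γ (C j)) + (8 / ((1 / 2 : ℝ) ^ j) ^ 2) •
      ((translate Γ γ (f j) - f k) * (translate Γ γ (f j) - f k))
  have hsm : ∀ γ j k, j < k →
      m (s γ j k) ≤ mVal Γ m (C k) - mVal Γ m (C j) + 32 * (1 / 2) ^ j := fun γ j k hjk => by
    have h1 : m (s γ j k) = mVal Γ m (C k) - mVal Γ m (C j) + 8 / ((1 / 2 : ℝ) ^ j) ^ 2 *
        m ((translate Γ γ (f j) - f k) * (translate Γ γ (f j) - f k)) := by
      simp only [s, map_add, map_sub, map_smul, hm.invariant, smul_eq_mul]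
      rfl
    have h2 : 8 / ((1 / 2 : ℝ) ^ j) ^ 2 * (4 * ((1 / 2 : ℝ) ^ j) ^ 3) = 32 * (1 / 2) ^ j := by
      have := (htpos j).ne'
      generalize (1 / 2 : ℝ) ^ j = t at this ⊢
      field_simp
      norm_num
    rw [h1, ← h2]
    gcongr
    exact hfm γ j k hjk.le
  have habs : ∀ γ j k, j < k → ∀ x,
      |translate Γ γ (ind Γ (C j)) x - ind Γ (C k) x| ≤ s γ j k x := fun γ j k hjk x => by
    simp only [s, BoundedContinuousFunction.add_apply, BoundedContinuousFunction.sub_apply,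
      BoundedContinuousFunction.smul_apply, BoundedContinuousFunction.mul_apply, smul_eq_mul,
      translate_apply, hind]
    exact abs_sub_levels_le (htpos j) (half_pow_le_half hjk)
  obtain ⟨L, ha, haL⟩ := exists_tendsto_of_almost_monotone (a := fun j => mVal Γ m (C j))
    (c := 32) (by norm_num) (fun j => hm.mVal_le_one _) fun j => by
      have h1 := hsm 0 j (j + 1) j.lt_succ_self
      have h2 := hm.nonneg (s 0 j (j + 1)) fun x =>
        (abs_nonneg _).trans (habs 0 j (j + 1) j.lt_succ_self x)
      linarith
  set e : ℕ → ℝ := fun j => L - mVal Γ m (C j) + 64 * (1 / 2) ^ j with he_def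
  have ht0 : Tendsto (fun j : ℕ => (1 / 2 : ℝ) ^ j) atTop (nhds 0) :=
    tendsto_pow_atTop_nhds_zero_of_lt_one (by norm_num) (by norm_num)
  have he : Tendsto e atTop (nhds 0) := by
    have := (ha.const_sub L).add (ht0.const_mul 64)
    rwa [sub_self, mul_zero, add_zero] at this
  have hse : ∀ γ j k, j < k → m (s γ j k) ≤ e j := fun γ j k hjk => by
    have := haL k
    simp only [he_def]
    linarith [hsm γ j k hjk, half_pow_le_half hjk]
  have hC : IsAsymptoticallyInvariant m C e := fun γ j k hjk =>
    ⟨s γ j k, habs γ j k hjk, hse γ j k hjk⟩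
  have hlow : ∀ j, m g ≤ m (f j * ind Γ (C j)) + (1 / 2) ^ j := fun j => by
    have := hm.mono (f := f j) (g := f j * ind Γ (C j) + ((1 / 2 : ℝ) ^ j) • 1) fun x => by
      simp only [BoundedContinuousFunction.add_apply, BoundedContinuousFunction.mul_apply,
        BoundedContinuousFunction.smul_apply, hind, BoundedContinuousFunction.coe_one,
        Pi.one_apply, smul_eq_mul, mul_one]
      split_ifs with h
      · linarith [htpos j]
      · linarith
    rwa [map_add, map_smul, hm.map_one, smul_eq_mul, mul_one, (hf j).2 m hm] at this
  have hL : 0 < L := by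
    have h : ∀ j, m g ≤ ‖g‖ * mVal Γ m (C j) + (1 / 2) ^ j := fun j => by
      have := hm.mono (f := f j * ind Γ (C j)) (g := ‖g‖ • ind Γ (C j)) fun x =>
        mul_le_mul_of_nonneg_right ((le_abs_self _).trans ((hf j).1 x))
          (Set.indicator_nonneg (fun _ _ => zero_le_one) x)
      rw [map_smul, smul_eq_mul] at this
      exact (hlow j).trans (add_le_add_left this _)
    have h' : m g ≤ ‖g‖ * L := by
      simpa using ge_of_tendsto' ((ha.const_mul ‖g‖).add ht0) h
    exact pos_of_mul_pos_right (hg.trans_le h') (norm_nonneg g)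
  obtain ⟨m', hm', ⟨C', L', hL', hrest⟩, happrox⟩ := hC.exists_isBetaRestriction hm he hL ha
  have hLg : m g ≤ L * m' g := by
    have h : ∀ j, m g ≤ L * m' g + ‖g‖ * e j + (1 / 2) ^ j := fun j => by
      have h1 := (abs_le.1 (happrox (f j) ‖g‖ (hf j).1 j)).2
      rw [(hf j).2 m' hm'] at h1
      linarith [hlow j]
    simpa using ge_of_tendsto' (((he.const_mul ‖g‖).const_add (L * m' g)).add ht0) h
  refine ⟨m', hm', ⟨C', L', le_trans ?_ hL', hrest⟩, ?_, ?_⟩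
  · calc κ * m g ≤ κ * (L * m' g) := by gcongr
      _ = L * (κ * m' g) := by ring
      _ ≤ L * 1 := by gcongr; exact hκg m' hm'
      _ = L := mul_one L
  · refine le_antisymm ?_ (hm'.nonneg u hu0)
    have hcutoff : ∀ j, L * m' u ≤ e j := fun j => by
      set c : ℝ := 2 / (1 / 2) ^ j
      have hc0 : 0 < c := div_pos two_pos (htpos j)
      have hbound : ∀ i, j < i → L * m' u ≤ e j + (1 + c * ‖g‖) * e i := fun i hji => by
        have h1 := hcut m' hm' (f i) (hf i) c hc0
        have h2 := (abs_le.1 (happrox ((1 - c • f i) ⊔ 0) (1 + c * ‖g‖) (fun x => by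
          have hx := abs_le.1 ((hf i).1 x)
          have hcx : c * (-‖g‖) ≤ c * f i x := by gcongr; exact hx.1
          have hcg : 0 ≤ c * ‖g‖ := by positivity
          change |max (1 - c * f i x) 0| ≤ _
          rw [abs_of_nonneg (le_max_right _ _)]
          exact max_le (by linarith) (by linarith)) i)).1
        have h3 : m (((1 - c • f i) ⊔ 0) * ind Γ (C i)) ≤ m (s 0 j i) := hm.mono fun x => by
          simp only [s, BoundedContinuousFunction.add_apply, BoundedContinuousFunction.sub_apply,
            BoundedContinuousFunction.smul_apply, BoundedContinuousFunction.mul_apply,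
            smul_eq_mul, translate_zero, hind]
          exact cutoff_mul_level_le (htpos j) (htpos i).le (half_pow_le_half hji)
        have h4 := mul_le_mul_of_nonneg_left h1 hL.le
        linarith [hse 0 j i hji]
      have hlim := (he.const_mul (1 + c * ‖g‖)).const_add (e j)
      rw [mul_zero, add_zero] at hlim
      exact ge_of_tendsto hlim (eventually_atTop.2 ⟨j + 1, fun i hi => hbound i hi⟩)
    exact nonpos_of_mul_nonpos_right (ge_of_tendsto' he hcutoff) hL
  · have hL1 : L ≤ 1 := le_of_tendsto' ha fun j => hm.mVal_le_one _
    have : 0 ≤ m' g := (pos_of_mul_pos_right (hg.trans_le hLg) hL.le).le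
    exact hLg.trans (mul_le_of_le_one_left this hL1)

end Means

theorem one_mean_restriction (A B : Set Γ) (hA : A.Nonempty) (hB : B.Nonempty)
    (K : AddSubgroup Γ) (hK : IsKJStabilizer Γ A B K)
    (m : BoundedContinuousFunction Γ ℝ →ₗ[ℝ] ℝ) (hm : IsInvariantMean Γ m)
    (δ : ℝ) (hδ : δ = mVal Γ m A + mVal Γ m B - mVal Γ m (A + B)) (hpos : 0 < δ) :
    ∃ m' : BoundedContinuousFunction Γ ℝ →ₗ[ℝ] ℝ, IsInvariantMean Γ m' ∧
      IsBetaRestriction Γ ((K.index : ℝ) * δ) m m' ∧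
      mVal Γ m' (A + B) = mVal Γ m' (A + B + (K : Set Γ)) ∧
      δ ≤ mVal Γ m' A + mVal Γ m' B - mVal Γ m' (A + B) := by

  obtain ⟨hfin, hK⟩ := hK
  have hk : (0 : ℝ) < K.index := Nat.cast_pos.2 (Nat.pos_of_ne_zero hfin.index_ne_zero)
  have hsub : ∀ S : Set Γ, S ⊆ S + (K : Set Γ) := fun S =>
    Set.subset_add_left S (zero_mem K)
  have hg : ∀ n : BoundedContinuousFunction Γ ℝ →ₗ[ℝ] ℝ,
      n (ind Γ A + ind Γ B - ind Γ (A + B)) = mVal Γ n A + mVal Γ n B - mVal Γ n (A + B) :=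
    fun n => by simp only [map_add, map_sub, mVal]
  have hu : ∀ n : BoundedContinuousFunction Γ ℝ →ₗ[ℝ] ℝ,
      n (ind Γ (A + B + (K : Set Γ)) - ind Γ (A + B)) =
        mVal Γ n (A + B + (K : Set Γ)) - mVal Γ n (A + B) := fun n => map_sub n _ _
  obtain ⟨m', hm', hrest, hm'u, hm'g⟩ := hm.exists_isBetaRestriction
    (g := ind Γ A + ind Γ B - ind Γ (A + B))
    (u := ind Γ (A + B + (K : Set Γ)) - ind Γ (A + B)) hk
    (fun x => sub_nonneg.2 (Set.indicator_le_indicator_of_subset (hsub (A + B))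
      (fun _ => zero_le_one) x))
    (fun x => (sub_le_self _ (Set.indicator_nonneg (fun _ _ => zero_le_one) x)).trans
      (Set.indicator_le_self' (fun _ _ => zero_le_one) x))
    (fun ν hν hpos => by
      rw [hg] at hpos ⊢
      rw [hu]
      obtain ⟨h1, h2, -⟩ := hK ν hν (by linarith)
      refine ⟨?_, by rw [h1, sub_self]⟩
      rw [← hν.1.index_mul_mVal_coe K]
      gcongr
      linarith [hν.1.mVal_mono (hsub A), hν.1.mVal_mono (hsub B)])
    (by rw [hg, ← hδ]; exact hpos)
  rw [hg, ← hδ] at hrest hm'g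
  rw [hg] at hm'g
  rw [hu, sub_eq_zero] at hm'u
  exact ⟨m', hm', hrest, hm'u.symm, hm'g⟩

end SumsetMeans
end

section
/- Let Γ be a discrete abelian group, m an invariant mean on ℓ^∞(Γ), K₀ ≤ Γ a finite-index subgroup, and A, B ⊆ Γ nonempty sets satisfying m(A+B) < m(A) + m(B) and m(A+B) = m(A+B+K₀). Let K := H(A+B+K₀) be the stabilizer of A+B+K₀. Then K₀ ≤ K ≤ Γ, K has finite index in Γ, A+B+K₀ = A+B+K, and m(A+B) = m(A+B+K) = m(A+K) + m(B+K) − m(K). -/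
open scoped Pointwise
open Filter

namespace SumsetMeans

variable (Γ : Type*) [AddCommGroup Γ] [TopologicalSpace Γ] [DiscreteTopology Γ]

/-- `C` is invariant under a subgroup `H` with `n ≤ |C| + |H|`. -/
def HasLargePeriod {G : Type*} [AddCommGroup G] (n : ℕ) (C : Finset G) : Prop :=
  ∃ H : AddSubgroup G, (∀ h ∈ H, ∀ c ∈ C, c + h ∈ C) ∧ n ≤ C.card + Nat.card H

section Kneser

variable {G : Type*} [AddCommGroup G]

theorem add_mem_iff_of_period {C : Finset G} {H : AddSubgroup G}
    (hC : ∀ h ∈ H, ∀ c ∈ C, c + h ∈ C) {h : G} (hh : h ∈ H) (c : G) :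
    c + h ∈ C ↔ c ∈ C :=
  ⟨fun hc => by simpa using hC (-h) (H.neg_mem hh) _ hc, hC h hh c⟩

theorem card_mul_card_le_of_add_mem [Finite G] {H₁ H₂ : AddSubgroup G} {X Y D : Finset G} (c : G)
    (hX : ∀ x ∈ X, x ∈ H₂) (hY : ∀ y ∈ Y, y ∈ H₁) (hD : ∀ x ∈ X, ∀ y ∈ Y, c + x + y ∈ D) :
    X.card * Y.card ≤ Nat.card (H₁ ⊓ H₂ : AddSubgroup G) * D.card := by
  classical
  have := Fintype.ofFinite G
  rw [← Finset.card_product]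
  refine Finset.card_le_mul_card_image_of_maps_to (f := fun p : G × G => c + p.1 + p.2)
    (fun p hp => ?_) _ (fun d _ => ?_)
  · rw [Finset.mem_product] at hp
    exact hD _ hp.1 _ hp.2
  · rcases Finset.eq_empty_or_nonempty
      ((X ×ˢ Y).filter fun p : G × G => c + p.1 + p.2 = d) with h | ⟨p₀, hp₀⟩
    · simp [h]
    · rw [Nat.card_eq_fintype_card, ← Finset.card_univ,
        ← Finset.card_map (Function.Embedding.subtype _)]
      rw [Finset.mem_filter, Finset.mem_product] at hp₀
      refine Finset.card_le_card_of_injOn (fun p => p.1 - p₀.1) (fun p hp => ?_) ?_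
      · simp only [Finset.coe_filter, Finset.mem_product, Set.mem_ofPred_eq] at hp
        have h2 : p.1 - p₀.1 ∈ H₂ := H₂.sub_mem (hX _ hp.1.1) (hX _ hp₀.1.1)
        have he : p.1 - p₀.1 = p₀.2 - p.2 := by
          have h := hp.2.trans hp₀.2.symm
          rw [add_assoc, add_assoc] at h
          have := add_left_cancel h
          rw [sub_eq_sub_iff_add_eq_add, this, add_comm]
        have h1 : p.1 - p₀.1 ∈ H₁ := he ▸ H₁.sub_mem (hY _ hp₀.1.2) (hY _ hp.1.2)
        simpa using And.intro h1 h2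
      · intro p hp q hq hpq
        simp only [Finset.coe_filter, Finset.mem_product, Set.mem_ofPred_eq] at hp hq
        have h1 : p.1 = q.1 := sub_left_injective hpq
        have h := hp.2.trans hq.2.symm
        rw [h1] at h
        exact Prod.ext h1 (add_left_cancel h)

theorem card_le_card_of_mem_of_period {H : AddSubgroup G} {X : Finset G}
    (hX : ∀ h ∈ H, ∀ x ∈ X, x + h ∈ X) {x : G} (hx : x ∈ X) : Nat.card H ≤ X.card := by
  rw [← Nat.card_eq_finsetCard]
  refine Nat.card_le_card_of_injective
    (fun h : H => (⟨x + h, hX h h.2 x hx⟩ : { y // y ∈ X })) fun a b hab => ?_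
  exact Subtype.ext (add_left_cancel (congrArg Subtype.val hab))

/-- If two sets periodic under `H₁` and `H₂` differ little from their union, then a whole coset of
`H₂` through any point of `C₂ \ C₁` lies in `C₂ \ C₁`. -/
theorem card_le_card_sdiff_of_period [Finite G] [DecidableEq G] {H₁ H₂ : AddSubgroup G}
    {C₁ C₂ : Finset G}
    (hC₁ : ∀ h ∈ H₁, ∀ c ∈ C₁, c + h ∈ C₁) (hC₂ : ∀ h ∈ H₂, ∀ c ∈ C₂, c + h ∈ C₂)
    (hlt₁ : (C₂ \ C₁).card + Nat.card (H₁ ⊓ H₂ : AddSubgroup G) < Nat.card H₁)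
    (hlt₂ : (C₁ \ C₂).card + Nat.card (H₁ ⊓ H₂ : AddSubgroup G) < Nat.card H₂)
    {c : G} (hc : c ∈ C₂ \ C₁) : Nat.card H₂ ≤ (C₂ \ C₁).card := by
  classical
  have := Fintype.ofFinite G
  rw [Finset.mem_sdiff] at hc
  have mem₁ := fun {h} (hh : h ∈ H₁) c => add_mem_iff_of_period hC₁ hh c
  have mem₂ := fun {h} (hh : h ∈ H₂) c => add_mem_iff_of_period hC₂ hh c
  set X := Finset.univ.filter fun x => x ∈ H₂ ∧ c + x ∉ C₁ with hXdef
  set X' := Finset.univ.filter fun x => x ∈ H₂ ∧ c + x ∈ C₁ with hX'def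
  set Y := Finset.univ.filter fun y => y ∈ H₁ ∧ c + y ∈ C₂ with hYdef
  set Y' := Finset.univ.filter fun y => y ∈ H₁ ∧ c + y ∉ C₂ with hY'def
  have hXX : X.card + X'.card = Nat.card H₂ := by
    rw [add_comm, Nat.card_eq_fintype_card, Fintype.card_subtype, hXdef, hX'def,
      ← Finset.filter_filter, ← Finset.filter_filter]
    exact Finset.card_filter_add_card_filter_not _
  have hYY : Y.card + Y'.card = Nat.card H₁ := by
    rw [Nat.card_eq_fintype_card, Fintype.card_subtype, hYdef, hY'def,
      ← Finset.filter_filter, ← Finset.filter_filter]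
    exact Finset.card_filter_add_card_filter_not _
  have hXY : X.card * Y.card ≤ Nat.card (H₁ ⊓ H₂ : AddSubgroup G) * (C₂ \ C₁).card := by
    refine card_mul_card_le_of_add_mem c (by simp +contextual [X]) (by simp +contextual [Y]) ?_
    intro x hx y hy
    simp only [X, Y, Finset.mem_filter, Finset.mem_univ, true_and] at hx hy
    rw [Finset.mem_sdiff, mem₁ hy.1, add_right_comm, mem₂ hx.1]
    exact ⟨hy.2, hx.2⟩
  have hXY' : X'.card * Y'.card ≤ Nat.card (H₁ ⊓ H₂ : AddSubgroup G) * (C₁ \ C₂).card := by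
    refine card_mul_card_le_of_add_mem c (by simp +contextual [X']) (by simp +contextual [Y']) ?_
    intro x hx y hy
    simp only [X', Y', Finset.mem_filter, Finset.mem_univ, true_and] at hx hy
    rw [Finset.mem_sdiff, mem₁ hy.1, add_right_comm, mem₂ hx.1]
    exact ⟨hx.2, hy.2⟩
  have hX0 : Nat.card (H₁ ⊓ H₂ : AddSubgroup G) ≤ X.card := by
    refine card_le_card_of_mem_of_period (x := 0) ?_ (by simpa [X] using hc.2)
    rintro h ⟨h1, h2⟩ x hx
    simp only [X, Finset.mem_filter, Finset.mem_univ, true_and] at hx ⊢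
    exact ⟨H₂.add_mem hx.1 h2, by rw [← add_assoc, mem₁ h1]; exact hx.2⟩
  have hY0 : Nat.card (H₁ ⊓ H₂ : AddSubgroup G) ≤ Y.card := by
    refine card_le_card_of_mem_of_period (x := 0) ?_ (by simpa [Y] using hc.1)
    rintro h ⟨h1, h2⟩ x hx
    simp only [Y, Finset.mem_filter, Finset.mem_univ, true_and] at hx ⊢
    exact ⟨H₁.add_mem hx.1 h1, by rw [← add_assoc, mem₂ h2]; exact hx.2⟩
  rcases X'.eq_empty_or_nonempty with hX' | ⟨x', hx'⟩
  · rw [← hXX, hX', Finset.card_empty, add_zero]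
    refine Finset.card_le_card_of_injOn (fun x => c + x) (fun x hx => ?_)
      (fun _ _ _ _ h => add_left_cancel h)
    simp only [X, Finset.coe_filter, Finset.mem_univ, true_and, Set.mem_ofPred_eq] at hx
    rw [Finset.mem_coe, Finset.mem_sdiff, mem₂ hx.1]
    exact ⟨hc.1, hx.2⟩
  · exfalso
    have hX'0 : Nat.card (H₁ ⊓ H₂ : AddSubgroup G) ≤ X'.card := by
      refine card_le_card_of_mem_of_period ?_ hx'
      rintro h ⟨h1, h2⟩ x hx
      simp only [X', Finset.mem_filter, Finset.mem_univ, true_and] at hx ⊢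
      exact ⟨H₂.add_mem hx.1 h2, by rw [← add_assoc, mem₁ h1]; exact hx.2⟩
    have hpos : 0 < Nat.card (H₁ ⊓ H₂ : AddSubgroup G) := Nat.card_pos
    generalize Nat.card (H₁ ⊓ H₂ : AddSubgroup G) = k at *
    rw [← hYY] at hlt₁
    rw [← hXX] at hlt₂
    obtain ⟨p, hp⟩ := Nat.exists_eq_add_of_le hX0
    obtain ⟨q, hq⟩ := Nat.exists_eq_add_of_le hY0
    obtain ⟨r, hr⟩ := Nat.exists_eq_add_of_le hX'0
    rw [hp, hq] at hXY
    rw [hr] at hXY'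
    rw [hq] at hlt₁
    rw [hp, hr] at hlt₂
    have h1 := Nat.mul_lt_mul_of_pos_left hlt₁ hpos
    have h2 := Nat.mul_lt_mul_of_pos_left hlt₂ hpos
    have h3 : k * (p + k) < k * Y'.card := by nlinarith [Nat.zero_le (p * q)]
    have h4 := lt_of_mul_lt_mul_left h3 (Nat.zero_le k)
    obtain ⟨s, hs⟩ := Nat.exists_eq_add_of_lt h4
    rw [hs] at hXY'
    nlinarith [Nat.zero_le (r * s), Nat.zero_le (r * p)]

theorem HasLargePeriod.union [Finite G] [DecidableEq G] {n : ℕ} {C₁ C₂ : Finset G}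
    (h₁ : HasLargePeriod n C₁) (h₂ : HasLargePeriod n C₂) : HasLargePeriod n (C₁ ∪ C₂) := by
  by_cases h12 : C₁ ⊆ C₂
  · rwa [Finset.union_eq_right.2 h12]
  by_cases h21 : C₂ ⊆ C₁
  · rwa [Finset.union_eq_left.2 h21]
  obtain ⟨c₁, hc₁⟩ := Finset.sdiff_nonempty.2 h12
  obtain ⟨c₂, hc₂⟩ := Finset.sdiff_nonempty.2 h21
  obtain ⟨H₁, hC₁, hn₁⟩ := h₁
  obtain ⟨H₂, hC₂, hn₂⟩ := h₂
  refine ⟨H₁ ⊓ H₂, ?_, ?_⟩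
  · rintro h ⟨hh₁, hh₂⟩ c hc
    rw [Finset.mem_union] at hc ⊢
    exact hc.imp (hC₁ h hh₁ c) (hC₂ h hh₂ c)
  · by_contra! hlt
    have e₁ := Finset.card_sdiff_add_card C₂ C₁
    have e₂ := Finset.card_sdiff_add_card C₁ C₂
    rw [Finset.union_comm] at e₁
    have hlt₁ : (C₂ \ C₁).card + Nat.card (H₁ ⊓ H₂ : AddSubgroup G) < Nat.card H₁ := by omega
    have hlt₂ : (C₁ \ C₂).card + Nat.card (H₁ ⊓ H₂ : AddSubgroup G) < Nat.card H₂ := by omega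
    have k₁ := card_le_card_sdiff_of_period hC₁ hC₂ hlt₁ hlt₂ hc₂
    rw [inf_comm] at hlt₁ hlt₂
    have k₂ := card_le_card_sdiff_of_period hC₂ hC₁ hlt₂ hlt₁ hc₁
    omega

theorem exists_hasLargePeriod_zero_mem [Finite G] [DecidableEq G] (A B : Finset G)
    (hA : 0 ∈ A) (hB : 0 ∈ B) :
    ∃ C ⊆ A + B, 0 ∈ C ∧ HasLargePeriod (A.card + B.card) C := by
  induction hn : B.card using Nat.strong_induction_on generalizing A B with
  | _ n ih =>
    by_cases h : ∀ e ∈ A, ∀ b ∈ B, e + b ∈ A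
    · refine ⟨A, fun a ha => by simpa using Finset.add_mem_add ha hB, hA,
        AddSubgroup.closure (B : Set G), fun k hk => ?_, ?_⟩
      · induction hk using AddSubgroup.closure_induction with
        | mem b hb => exact fun a ha => h a ha b hb
        | zero => simp
        | add x y _ _ hx hy =>
            intro a ha
            rw [← add_assoc]
            exact hy _ (hx a ha)
        | neg x _ hx =>
            intro a ha
            obtain ⟨a', ha'⟩ := (Finite.injective_iff_surjective (f := fun a : { a // a ∈ A } =>
              (⟨a + x, hx a a.2⟩ : { a // a ∈ A }))).1
              (fun a b hab => Subtype.ext (add_right_cancel (congrArg Subtype.val hab))) ⟨a, ha⟩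
            have : (a' : G) + x = a := congrArg Subtype.val ha'
            rw [← this, add_neg_cancel_right]
            exact a'.2
      · rw [← hn, ← Nat.card_eq_finsetCard B]
        exact Nat.add_le_add_left (Nat.card_le_card_of_injective
          (fun b : { b // b ∈ B } =>
            (⟨b, AddSubgroup.subset_closure b.2⟩ : AddSubgroup.closure (B : Set G)))
          fun _ _ hab => Subtype.ext (Subtype.mk.inj hab)) _
    · push Not at h
      obtain ⟨e, he, b, hb, heb⟩ := h
      set A' := A ∪ B.image (e + ·) with hA'
      set B' := B.filter fun b => e + b ∈ A with hB'
      have hcard : A'.card + B'.card = A.card + B.card := by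
        have h1 := Finset.card_union_add_card_inter A (B.image (e + ·))
        have h2 : A ∩ B.image (e + ·) = B'.image (e + ·) := by
          ext x
          simp only [hB', Finset.mem_inter, Finset.mem_image, Finset.mem_filter]
          constructor
          · rintro ⟨hx, y, hy, rfl⟩
            exact ⟨y, ⟨hy, hx⟩, rfl⟩
          · rintro ⟨y, ⟨hy, hx⟩, rfl⟩
            exact ⟨hx, y, hy, rfl⟩
        rwa [h2, Finset.card_image_of_injective _ (add_right_injective e),
          Finset.card_image_of_injective _ (add_right_injective e)] at h1
      have hlt : B'.card < n := by
        rw [← hn]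
        exact Finset.card_lt_card (Finset.filter_ssubset.2 ⟨b, hb, heb⟩)
      obtain ⟨C, hC, h0, hP⟩ := ih _ hlt A' B' (Finset.mem_union_left _ hA)
        (by simpa [hB'] using ⟨hB, he⟩) rfl
      refine ⟨C, hC.trans ?_, h0, by rwa [← hn, ← hcard]⟩
      rw [Finset.add_subset_iff]
      intro x hx y hy
      rw [hB', Finset.mem_filter] at hy
      rw [hA', Finset.mem_union, Finset.mem_image] at hx
      rcases hx with hx | ⟨z, hz, rfl⟩
      · exact Finset.add_mem_add hx hy.1
      · rw [add_right_comm]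
        exact Finset.add_mem_add hy.2 hz

theorem exists_hasLargePeriod_mem [Finite G] [DecidableEq G] {A B : Finset G} {a b : G}
    (ha : a ∈ A) (hb : b ∈ B) :
    ∃ C ⊆ A + B, a + b ∈ C ∧ HasLargePeriod (A.card + B.card) C := by
  obtain ⟨C, hC, h0, H, hH, hn⟩ := exists_hasLargePeriod_zero_mem (A.image (· - a)) (B.image (· - b))
    (Finset.mem_image.2 ⟨a, ha, sub_self a⟩) (Finset.mem_image.2 ⟨b, hb, sub_self b⟩)
  refine ⟨C.image (· + (a + b)), ?_, Finset.mem_image.2 ⟨0, h0, zero_add _⟩, H, ?_, ?_⟩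
  · intro x hx
    obtain ⟨c, hc, rfl⟩ := Finset.mem_image.1 hx
    obtain ⟨u, hu, v, hv, rfl⟩ := Finset.mem_add.1 (hC hc)
    obtain ⟨u, hu', rfl⟩ := Finset.mem_image.1 hu
    obtain ⟨v, hv', rfl⟩ := Finset.mem_image.1 hv
    simp only [sub_add_sub_comm, sub_add_cancel]
    exact Finset.add_mem_add hu' hv'
  · intro h hh x hx
    obtain ⟨c, hc, rfl⟩ := Finset.mem_image.1 hx
    exact Finset.mem_image.2 ⟨c + h, hH h hh c hc, add_right_comm _ _ _⟩
  · rwa [Finset.card_image_of_injective _ (sub_left_injective),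
      Finset.card_image_of_injective _ (sub_left_injective),
      ← Finset.card_image_of_injective C (add_left_injective (a + b))] at hn

/-- **Kneser's theorem** for finite abelian groups. -/
theorem hasLargePeriod_add [Finite G] [DecidableEq G] {A B : Finset G} (hA : A.Nonempty)
    (hB : B.Nonempty) : HasLargePeriod (A.card + B.card) (A + B) := by
  suffices h : ∀ S : Finset G, S.Nonempty → S ⊆ A + B →
      ∃ C ⊆ A + B, S ⊆ C ∧ HasLargePeriod (A.card + B.card) C by
    obtain ⟨C, hC, hC', hP⟩ := h _ (hA.add hB) subset_rfl
    rwa [hC'.antisymm hC]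
  intro S hS
  induction hS using Finset.Nonempty.cons_induction with
  | singleton x =>
    intro hx
    obtain ⟨a, ha, b, hb, rfl⟩ := Finset.mem_add.1 (Finset.singleton_subset_iff.1 hx)
    obtain ⟨C, hC, hab, hP⟩ := exists_hasLargePeriod_mem ha hb
    exact ⟨C, hC, Finset.singleton_subset_iff.2 hab, hP⟩
  | cons x S hx _ ih =>
    intro hsub
    rw [Finset.cons_eq_insert, Finset.insert_subset_iff] at hsub
    obtain ⟨a, ha, b, hb, hab⟩ := Finset.mem_add.1 hsub.1
    obtain ⟨C, hC, hxC, hP⟩ := exists_hasLargePeriod_mem ha hb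
    obtain ⟨D, hD, hSD, hQ⟩ := ih hsub.2
    refine ⟨C ∪ D, Finset.union_subset hC hD, ?_, hP.union hQ⟩
    rw [Finset.cons_eq_insert, Finset.insert_subset_iff]
    exact ⟨Finset.mem_union_left _ (hab ▸ hxC), hSD.trans Finset.subset_union_right⟩

theorem add_addSubgroup_eq_preimage_image (K : AddSubgroup G) (S : Set G) :
    S + (K : Set G) = ((↑) : G → G ⧸ K) ⁻¹' ((↑) '' S) := by
  ext x
  simp only [Set.mem_add, Set.mem_preimage, Set.mem_image, SetLike.mem_coe, QuotientAddGroup.eq]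
  constructor
  · rintro ⟨s, hs, k, hk, rfl⟩
    exact ⟨s, hs, by simpa using hk⟩
  · rintro ⟨s, hs, h⟩
    exact ⟨s, hs, _, h, add_neg_cancel_left _ _⟩

end Kneser

section Additivity

variable {α : Type*} [TopologicalSpace α] [DiscreteTopology α]
  {m : BoundedContinuousFunction α ℝ →ₗ[ℝ] ℝ}

theorem mVal_empty : mVal α m ∅ = 0 := by
  have : ind α (∅ : Set α) = 0 := by ext x; simp [ind]
  rw [mVal, this, map_zero]

theorem mVal_union {S T : Set α} (h : Disjoint S T) :
    mVal α m (S ∪ T) = mVal α m S + mVal α m T := by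
  rw [mVal, mVal, mVal, ← map_add]
  congr 1
  ext x
  exact congrFun (Set.indicator_union_of_disjoint h 1) x

end Additivity

section InvariantMean

variable {Γ} {m : BoundedContinuousFunction Γ ℝ →ₗ[ℝ] ℝ}

theorem IsInvariantMean.mVal_mono_s7 (hm : IsInvariantMean Γ m) {S T : Set Γ} (h : S ⊆ T) :
    mVal Γ m S ≤ mVal Γ m T := by
  rw [← sub_nonneg, mVal, mVal, ← map_sub]
  exact hm.nonneg _ fun x => sub_nonneg.2
    (Set.indicator_le_indicator_of_subset h (fun _ => zero_le_one) x)

theorem IsInvariantMean.mVal_preimage_sub (hm : IsInvariantMean Γ m) (γ : Γ) (S : Set Γ) :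
    mVal Γ m ((· - γ) ⁻¹' S) = mVal Γ m S := by
  rw [mVal, mVal, ← hm.invariant γ (ind Γ S)]
  rfl

theorem IsInvariantMean.mVal_preimage_mk (hm : IsInvariantMean Γ m) (K : AddSubgroup Γ)
    (T : Finset (Γ ⧸ K)) :
    mVal Γ m ((↑) ⁻¹' (T : Set (Γ ⧸ K))) = T.card * mVal Γ m (K : Set Γ) := by
  classical
  induction T using Finset.induction_on with
  | empty => simp [mVal_empty]
  | insert t T ht ih =>
    obtain ⟨γ, rfl⟩ := QuotientAddGroup.mk_surjective t
    have hγ : ((↑) : Γ → Γ ⧸ K) ⁻¹' {(γ : Γ ⧸ K)} = (· - γ) ⁻¹' (K : Set Γ) := by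
      ext x
      rw [Set.mem_preimage, Set.mem_singleton_iff, eq_comm, QuotientAddGroup.eq,
        neg_add_eq_sub]
      rfl
    rw [Finset.coe_insert, Set.insert_eq, Set.preimage_union, mVal_union, ih, hγ,
      hm.mVal_preimage_sub, Finset.card_insert_of_notMem ht]
    · push_cast
      ring
    · exact Disjoint.preimage _ (by simpa using ht)

theorem IsInvariantMean.mVal_add_addSubgroup (hm : IsInvariantMean Γ m) (K : AddSubgroup Γ) [Finite (Γ ⧸ K)]
    (S : Set Γ) :
    mVal Γ m (S + (K : Set Γ)) =
      (((↑) '' S : Set (Γ ⧸ K)).toFinite.toFinset.card : ℝ) * mVal Γ m (K : Set Γ) := by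
  rw [add_addSubgroup_eq_preimage_image, ← hm.mVal_preimage_mk, Set.Finite.coe_toFinset]

/-- The Kneser equality for means, when the sumset is periodic exactly under `K`. -/
theorem IsInvariantMean.mVal_add_eq_of_stabilizer (hm : IsInvariantMean Γ m) (K : AddSubgroup Γ)
    [K.FiniteIndex] {A B : Set Γ} (hA : A.Nonempty) (hB : B.Nonempty)
    (hK : ∀ γ, (∀ x, x + γ ∈ A + B + (K : Set Γ) ↔ x ∈ A + B + (K : Set Γ)) → γ ∈ K)
    (hlt : mVal Γ m (A + B + (K : Set Γ)) < mVal Γ m A + mVal Γ m B) :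
    mVal Γ m (A + B + (K : Set Γ)) =
      mVal Γ m (A + (K : Set Γ)) + mVal Γ m (B + (K : Set Γ)) - mVal Γ m (K : Set Γ) := by
  classical
  have sub (S : Set Γ) : S ⊆ S + (K : Set Γ) := fun s hs => ⟨s, hs, 0, K.zero_mem, add_zero s⟩
  replace hlt := hlt.trans_le (add_le_add (hm.mVal_mono_s7 (sub A)) (hm.mVal_mono_s7 (sub B)))
  have hpos : 0 ≤ mVal Γ m (K : Set Γ) := by
    rw [← mVal_empty (m := m)]
    exact hm.mVal_mono_s7 (Set.empty_subset _)
  rw [hm.mVal_add_addSubgroup, hm.mVal_add_addSubgroup, hm.mVal_add_addSubgroup] at hlt ⊢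
  set A' := ((↑) '' A : Set (Γ ⧸ K)).toFinite.toFinset with hA'
  set B' := ((↑) '' B : Set (Γ ⧸ K)).toFinite.toFinset with hB'
  set C' := ((↑) '' (A + B) : Set (Γ ⧸ K)).toFinite.toFinset with hC'
  have hadd : C' = A' + B' := by
    apply Finset.coe_injective
    rw [Finset.coe_add, hA', hB', hC', Set.Finite.coe_toFinset, Set.Finite.coe_toFinset,
      Set.Finite.coe_toFinset]
    exact Set.image_add (QuotientAddGroup.mk' K)
  obtain ⟨H, hH, hn⟩ := hasLargePeriod_add (A := A') (B := B') (by simpa [hA'] using hA)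
    (by simpa [hB'] using hB)
  rw [← hadd] at hH hn
  have hbot : H = ⊥ := by
    rw [AddSubgroup.eq_bot_iff_forall]
    intro h hh
    obtain ⟨γ, rfl⟩ := QuotientAddGroup.mk_surjective h
    rw [QuotientAddGroup.eq_zero_iff]
    refine hK γ fun x => ?_
    rw [add_addSubgroup_eq_preimage_image]
    simpa only [hC', Set.Finite.mem_toFinset, Set.mem_preimage, QuotientAddGroup.mk_add] using
      add_mem_iff_of_period hH hh (x : Γ ⧸ K)
  rw [hbot, AddSubgroup.card_bot] at hn
  rw [← add_mul] at hlt
  have hlt' : C'.card < A'.card + B'.card := by exact_mod_cast lt_of_mul_lt_mul_right hlt hpos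
  have heq : (A'.card : ℝ) + B'.card = C'.card + 1 := by
    exact_mod_cast (by omega : A'.card + B'.card = C'.card + 1)
  linear_combination -mVal Γ m (K : Set Γ) * heq

end InvariantMean

theorem finite_index_to_kneser (m : BoundedContinuousFunction Γ ℝ →ₗ[ℝ] ℝ)
    (hm : IsInvariantMean Γ m)
    (K₀ : AddSubgroup Γ) (hK₀ : K₀.FiniteIndex)
    (A B : Set Γ) (hA : A.Nonempty) (hB : B.Nonempty)
    (hlt : mVal Γ m (A + B) < mVal Γ m A + mVal Γ m B)
    (hstable : mVal Γ m (A + B) = mVal Γ m (A + B + (K₀ : Set Γ))) :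
    ∃ K : AddSubgroup Γ,
      (K : Set Γ) =
        {γ : Γ | A + B + (K₀ : Set Γ) + {γ} = A + B + (K₀ : Set Γ)} ∧
      K₀ ≤ K ∧ K.FiniteIndex ∧
      A + B + (K₀ : Set Γ) = A + B + (K : Set Γ) ∧
      mVal Γ m (A + B) = mVal Γ m (A + B + (K : Set Γ)) ∧
      mVal Γ m (A + B + (K : Set Γ)) =
        mVal Γ m (A + (K : Set Γ)) + mVal Γ m (B + (K : Set Γ)) - mVal Γ m (K : Set Γ) := by
  set S := A + B + (K₀ : Set Γ) with hS
  have mem_stab (γ : Γ) : γ ∈ AddAction.stabilizer Γ S ↔ S + {γ} = S := by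
    rw [AddAction.mem_stabilizer_iff, Set.add_singleton, ← Set.image_vadd]
    simp only [vadd_eq_add, add_comm]
  have hK₀K : K₀ ≤ AddAction.stabilizer Γ S := fun k hk => by
    rw [mem_stab, hS, add_assoc]
    congr 1
    ext x
    simp only [Set.add_singleton, Set.mem_image, SetLike.mem_coe]
    exact ⟨fun ⟨y, hy, h⟩ => h ▸ K₀.add_mem hy hk,
      fun hx => ⟨x - k, K₀.sub_mem hx hk, sub_add_cancel x k⟩⟩
  have hSK : S = A + B + (AddAction.stabilizer Γ S : Set Γ) := by
    apply Set.Subset.antisymm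
    · exact Set.add_subset_add_left hK₀K
    · rintro _ ⟨x, hx, k, hk, rfl⟩
      rw [SetLike.mem_coe, mem_stab] at hk
      rw [← hk]
      exact Set.add_mem_add ⟨x, hx, 0, K₀.zero_mem, add_zero x⟩ rfl
  have hfin : (AddAction.stabilizer Γ S).FiniteIndex := AddSubgroup.finiteIndex_of_le hK₀K
  refine ⟨AddAction.stabilizer Γ S, Set.ext mem_stab, hK₀K, hfin, hSK, by rw [← hSK, hstable], ?_⟩
  refine hm.mVal_add_eq_of_stabilizer _ hA hB (fun γ h => ?_) (by rwa [← hSK, ← hstable])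
  rw [← hSK] at h
  rw [mem_stab, Set.add_singleton]
  ext x
  constructor
  · rintro ⟨y, hy, rfl⟩
    exact (h y).2 hy
  · exact fun hx => ⟨x - γ, (h _).1 (by rwa [sub_add_cancel]), sub_add_cancel x γ⟩

end SumsetMeans
end
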